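/- Pfaffian of a bordered skew-symmetric matrix: if n + m is even, Z is an n×n skew-symmetric matrix and W is an n×m matrix, then Pf[[Z, W], [-Wᵀ, 0]] equals Σ_I (-1)^{Σ(I) + C(n,2)} Pf(Z(I)) det W([n]\I; [m]) when n > m (sum over (n-m)-element subsets I of [n]); equals (-1)^{C(n,2)} det W when n = m; and equals 0 when n < m. -/

import Mathlib

open Matrix

/-- The Pfaffian of an `N × N` matrix, via the Laplace-type expansion along the first row.
For odd `N` it is `0`, matching the convention that only even-sized skew-symmetric matrices
have a (possibly nonzero) Pfaffian. -/
noncomputable def pf (R : Type*) [CommRing R] : (N : ℕ) → Matrix (Fin N) (Fin N) R → R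
  | 0, _ => 1
  | 1, _ => 0
  | (N+2), A => ∑ j : Fin (N+1), (-1 : R)^(j:ℕ) * A 0 j.succ *
      pf R N (fun a b => A ((j.succAbove a).succ) ((j.succAbove b).succ))

section ListExpansions

variable {α β R : Type*} [CommRing R]

/-- The alternating sum `∑ₖ (-1)ᵏ f lₖ (l with its k-th entry removed)` over the entries of `l`. -/
def altSum : List α → (α → List α → R) → R
  | [], _ => 0
  | a :: l, f => f a l - altSum l fun x r => f x (a :: r)

/-- The sum of `F I J` over all ways of splitting `l` into complementary sublists `I` and `J`,
signed by the parity of the shuffle that turns `I ++ J` into `l`. -/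
def splitSum : List α → (List α → List α → R) → R
  | [], F => F [] []
  | a :: l, F => splitSum l (fun I J => F (a :: I) J) +
      splitSum l fun I J => (-1) ^ I.length * F I (a :: J)

/-- The determinant of `W` with rows and columns listed by two lists, expanded along the first row;
it vanishes when the lists have different lengths. -/
def listDet (W : Matrix α β R) : List α → List β → R
  | [], [] => 1
  | [], _ :: _ => 0
  | a :: l, cs => altSum cs fun x r => W a x * listDet W l r

/-- The Pfaffian of `G` with rows and columns listed by a list, expanded along the first row. -/
def listPf (G : Matrix α α R) : List α → R
  | [] => 1
  | a :: l => ∑ k : Fin l.length, (-1) ^ (k : ℕ) * (G a l[k] * listPf G (l.eraseIdx k))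
termination_by l => l.length
decreasing_by grind

theorem altSum_eq_sum (l : List α) (f : α → List α → R) :
    altSum l f = ∑ k : Fin l.length, (-1) ^ (k : ℕ) * f l[k] (l.eraseIdx k) := by
  induction l generalizing f with
  | nil => simp [altSum]
  | cons a l ih => simp [altSum, ih, Fin.sum_univ_succ, pow_succ, sub_eq_add_neg]

theorem listPf_cons (G : Matrix α α R) (a : α) (l : List α) :
    listPf G (a :: l) = altSum l fun x r => G a x * listPf G r := by
  rw [listPf, altSum_eq_sum]

theorem altSum_congr {l : List α} {f g : α → List α → R}
    (h : ∀ x r, r.length + 1 = l.length → f x r = g x r) : altSum l f = altSum l g := by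
  induction l generalizing f g with
  | nil => rfl
  | cons a l ih =>
    rw [altSum, altSum, h a l rfl, ih fun x r hr => h x (a :: r) (by simpa using hr)]

theorem altSum_mul_left (c : R) (l : List α) (f : α → List α → R) :
    altSum l (fun x r => c * f x r) = c * altSum l f := by
  simp only [altSum_eq_sum, Finset.mul_sum, mul_left_comm]

theorem altSum_add (l : List α) (f g : α → List α → R) :
    altSum l (fun x r => f x r + g x r) = altSum l f + altSum l g := by
  simp only [altSum_eq_sum, ← Finset.sum_add_distrib, mul_add]

theorem altSum_zero (l : List α) : altSum l (fun _ _ => (0 : R)) = 0 := by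
  simp [altSum_eq_sum]

theorem altSum_map (g : α → β) (l : List α) (f : β → List β → R) :
    altSum (l.map g) f = altSum l fun x r => f (g x) (r.map g) := by
  induction l generalizing f with
  | nil => rfl
  | cons a l ih => simp [altSum, ih]

theorem altSum_append (l₁ l₂ : List α) (f : α → List α → R) :
    altSum (l₁ ++ l₂) f = altSum l₁ (fun x r => f x (r ++ l₂)) +
      (-1) ^ l₁.length * altSum l₂ fun x r => f x (l₁ ++ r) := by
  induction l₁ generalizing f with
  | nil => simp [altSum]
  | cons a l ih => simp only [altSum, ih, List.cons_append, List.length_cons]; ring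

theorem altSum_ofFn {n : ℕ} (g : Fin (n + 1) → α) (f : α → List α → R) :
    altSum (List.ofFn g) f =
      ∑ j : Fin (n + 1), (-1) ^ (j : ℕ) * f (g j) (List.ofFn fun i => g (j.succAbove i)) := by
  induction n generalizing f with
  | zero => simp [altSum]
  | succ n ih =>
    rw [List.ofFn_succ, altSum, ih, Fin.sum_univ_succ, Fin.sum_univ_succ, Fin.sum_univ_succ]
    have h (j : Fin (n + 1)) : (g 0 :: List.ofFn fun i => g (j.succAbove i).succ) =
        List.ofFn fun i => g (j.succ.succAbove i) := by
      simp
    simp only [h]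
    simp [pow_succ]
    ring

theorem splitSum_congr {l : List α} {F H : List α → List α → R}
    (h : ∀ I J, I.length + J.length = l.length → F I J = H I J) :
    splitSum l F = splitSum l H := by
  induction l generalizing F H with
  | nil => exact h [] [] rfl
  | cons a l ih =>
    rw [splitSum, splitSum]
    congr 1
    · exact ih fun I J hl => h _ _ (by simp; omega)
    · exact ih fun I J hl => by rw [h _ _ (by simp; omega)]

theorem splitSum_add (l : List α) (F H : List α → List α → R) :
    splitSum l (fun I J => F I J + H I J) = splitSum l F + splitSum l H := by
  induction l generalizing F H with
  | nil => rfl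
  | cons a l ih => simp only [splitSum, mul_add, ih]; ring

theorem splitSum_mul_left (c : R) (l : List α) (F : List α → List α → R) :
    splitSum l (fun I J => c * F I J) = c * splitSum l F := by
  induction l generalizing F with
  | nil => rfl
  | cons a l ih => simp only [splitSum, mul_left_comm _ c, ih]; ring

theorem splitSum_sub (l : List α) (F H : List α → List α → R) :
    splitSum l (fun I J => F I J - H I J) = splitSum l F - splitSum l H := by
  have h := splitSum_add l F fun I J => -1 * H I J
  rw [splitSum_mul_left] at h
  simpa [sub_eq_add_neg] using h

theorem splitSum_zero (l : List α) : splitSum l (fun _ _ => (0 : R)) = 0 := by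
  simpa using splitSum_mul_left (0 : R) l fun _ _ => 0

theorem altSum_splitSum_comm (l : List α) (cs : List β)
    (F : β → List β → List α → List α → R) :
    altSum cs (fun x r => splitSum l (F x r)) =
      splitSum l fun I J => altSum cs fun x r => F x r I J := by
  induction cs generalizing F with
  | nil => simp [altSum, splitSum_zero]
  | cons c cs ih => simp only [altSum, ih, splitSum_sub]

/-- Removing an entry of `l` and then splitting is the same as splitting `l` and then removing an
entry of the first part. -/
theorem altSum_splitSum (l : List α) (f : α → List α → List α → R) :
    altSum l (fun x r => splitSum r (f x)) =
      splitSum l fun I J => altSum I fun x r => f x r J := by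
  induction l generalizing f with
  | nil => rfl
  | cons a l ih =>
    simp only [altSum, splitSum, splitSum_sub, altSum_add]
    rw [ih fun x I J => f x (a :: I) J, ih fun x I J => (-1) ^ I.length * f x I (a :: J)]
    have h : splitSum l (fun I J => (-1) ^ I.length * altSum I fun x r => f x r (a :: J)) =
        -splitSum l fun I J => altSum I fun x r => (-1) ^ r.length * f x r (a :: J) := by
      rw [eq_neg_iff_add_eq_zero, ← splitSum_add, ← splitSum_zero l]
      refine splitSum_congr fun I J _ => ?_
      rw [← altSum_mul_left, ← altSum_add, ← altSum_zero I]
      refine altSum_congr fun x r hr => ?_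
      rw [← hr]; ring
    rw [h]; ring

theorem listDet_eq_zero (W : Matrix α β R) {rs : List α} {cs : List β}
    (h : rs.length ≠ cs.length) : listDet W rs cs = 0 := by
  induction rs generalizing cs with
  | nil => cases cs <;> simp_all [listDet]
  | cons a l ih =>
    rw [listDet, ← altSum_zero cs]
    refine altSum_congr fun x r hr => ?_
    rw [ih (by simp at h; omega), mul_zero]

theorem listPf_append (Z : Matrix α α R) (W : Matrix α β R) (V : Matrix β α R)
    (zs : List α) (ws : List β) :
    listPf (Matrix.fromBlocks Z W V 0) (zs.map .inl ++ ws.map .inr) = (-1) ^ ws.length.choose 2 *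
      splitSum zs fun I J => listPf Z I *
        listDet W J ws := by
  induction hN : zs.length using Nat.strong_induction_on generalizing zs ws with
  | _ N ih =>
  subst hN
  cases zs with
  | nil =>
    cases ws with
    | nil => simp [listPf, splitSum, listDet]
    | cons w ws =>
      simp [listPf_cons, splitSum, listDet, altSum_map, altSum_zero]
  | cons a l =>
    rw [List.map_cons, List.cons_append, listPf_cons, altSum_append, altSum_map, altSum_map,
      splitSum, mul_add]
    congr 1
    · rw [← altSum_congr (f := fun x r => (-1) ^ ws.length.choose 2 * splitSum r fun I J =>
        Z a x * (listPf Z I *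
          listDet W J ws)), altSum_mul_left, altSum_splitSum]
      · congr 1
        refine splitSum_congr fun I J _ => ?_
        rw [listPf_cons, mul_comm, ← altSum_mul_left]
        exact altSum_congr fun x r _ => by ring
      · intro x r hr
        rw [ih r.length (by simp; omega) r ws rfl, Matrix.fromBlocks_apply₁₁, splitSum_mul_left]
        ring
    · rw [List.length_map, ← altSum_congr (f := fun x r => (-1) ^ (ws.length - 1).choose 2 *
        splitSum l fun I J => W a x * (listPf Z I *
          listDet W J r)), altSum_mul_left, altSum_splitSum_comm,
          ← splitSum_mul_left, ← splitSum_mul_left, ← splitSum_mul_left]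
      · refine splitSum_congr fun I J hIJ => ?_
        by_cases hJ : J.length + 1 = ws.length
        · rw [listDet, ← altSum_mul_left, ← altSum_mul_left, ← altSum_mul_left,
            ← altSum_mul_left, ← altSum_mul_left]
          refine altSum_congr fun x r _ => ?_
          rw [← hJ, ← hIJ, Nat.choose_succ_succ' J.length 1, Nat.choose_one_right,
            Nat.add_sub_cancel]
          ring
        · rw [listDet_eq_zero _ (by simpa using hJ)]
          simp only [mul_zero]
          rw [altSum_congr (g := fun _ _ => 0), altSum_zero, mul_zero, mul_zero]
          intro x r hr
          rw [listDet_eq_zero _ (by omega), mul_zero, mul_zero]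
      · intro x r hr
        rw [ih l.length (by simp) l r rfl, Matrix.fromBlocks_apply₁₂, splitSum_mul_left, ← hr,
          Nat.add_sub_cancel]
        ring
theorem listDet_ofFn (W : Matrix α β R) {n : ℕ} (f : Fin n → α) (g : Fin n → β) :
    listDet W (List.ofFn f) (List.ofFn g) = (W.submatrix f g).det := by
  induction n with
  | zero => simp [listDet]
  | succ n ih =>
    rw [List.ofFn_succ (f := f), listDet, altSum_ofFn, Matrix.det_succ_row_zero]
    refine Finset.sum_congr rfl fun j _ => ?_
    rw [ih, mul_assoc]
    rfl

theorem listPf_ofFn (G : Matrix α α R) {n : ℕ} (g : Fin n → α) :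
    listPf G (List.ofFn g) = pf R n (G.submatrix g g) := by
  induction n using Nat.twoStepInduction with
  | zero => simp [listPf, pf]
  | one => simp [listPf, pf]
  | more n ih _ =>
    rw [List.ofFn_succ, listPf_cons, altSum_ofFn, pf.eq_def]
    refine Finset.sum_congr rfl fun j _ => ?_
    rw [ih, mul_assoc]
    rfl

theorem sum_finset_fin_succ {M : Type*} [AddCommMonoid M] {n : ℕ} (f : Finset (Fin (n + 1)) → M) :
    ∑ I, f I = ∑ I : Finset (Fin n), f (insert 0 (I.map (Fin.succEmb n))) +
      ∑ I : Finset (Fin n), f (I.map (Fin.succEmb n)) := by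
  rw [← Finset.powerset_univ, Fin.univ_succ, Finset.cons_eq_insert,
    Finset.sum_powerset_insert (by simp),
    Finset.map_eq_image, Finset.powerset_image, add_comm]
  have hinj : Function.Injective (Finset.image (Fin.succ (n := n))) :=
    Finset.image_injective (Fin.succ_injective n)
  simp [Finset.sum_image hinj.injOn, Finset.map_eq_image]

theorem splitSum_ofFn {n : ℕ} (g : Fin n → α) (F : List α → List α → R) :
    splitSum (List.ofFn g) F = ∑ I : Finset (Fin n),
      (-1) ^ (∑ i ∈ I, (i : ℕ) + I.card.choose 2) * F (I.sort.map g) (Iᶜ.sort.map g) := by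
  induction n generalizing F with
  | zero => simp [splitSum, Subsingleton.elim _ (∅ : Finset (Fin 0))]
  | succ n ih =>
    have hsort (I : Finset (Fin n)) : (I.map (Fin.succEmb n)).sort = I.sort.map Fin.succ :=
      ((Fin.strictMono_succ.strictMonoOn _).map_finsetSort (f := Fin.succEmb n)).symm
    have hins (I : Finset (Fin n)) :
        (insert 0 (I.map (Fin.succEmb n))).sort = 0 :: I.sort.map Fin.succ := by
      rw [Finset.sort_insert _ (by simp) (by simp), hsort]
    have hc (I : Finset (Fin n)) :
        (I.map (Fin.succEmb n))ᶜ = insert 0 (Iᶜ.map (Fin.succEmb n)) := by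
      ext i; cases i using Fin.cases <;> simp
    have hc' (I : Finset (Fin n)) :
        (insert 0 (I.map (Fin.succEmb n)))ᶜ = Iᶜ.map (Fin.succEmb n) := by
      ext i; cases i using Fin.cases <;> simp
    rw [List.ofFn_succ, splitSum, ih, ih, sum_finset_fin_succ]
    congr 1 <;> refine Finset.sum_congr rfl fun I _ => ?_
    · rw [hc', hins, hsort, Finset.sum_insert (by simp), Finset.card_insert_of_notMem (by simp),
        Finset.card_map, Finset.sum_map, Nat.choose_succ_succ' _ 1]
      simp [Finset.sum_add_distrib, Function.comp_def, pow_add]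
      ring_nf
      simp
    · rw [hc, hins, hsort, Finset.card_map, Finset.sum_map]
      simp [Finset.sum_add_distrib, Function.comp_def, pow_add]
      ring

theorem choose_two_add (m n : ℕ) :
    (m + n).choose 2 = m.choose 2 + n.choose 2 + m * n := by
  induction n with
  | zero => simp
  | succ n ih =>
    rw [← add_assoc, Nat.choose_succ_succ' _ 1, ih, Nat.choose_succ_succ' n 1,
      Nat.choose_one_right, Nat.choose_one_right]
    ring

theorem pf_fromBlocks_zero (n m : ℕ) (Z : Matrix (Fin n) (Fin n) R) (W : Matrix (Fin n) (Fin m) R)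
    (V : Matrix (Fin m) (Fin n) R) :
    pf R (n + m) ((Matrix.fromBlocks Z W V 0).submatrix
        finSumFinEquiv.symm finSumFinEquiv.symm) =
      ∑ I : Finset (Fin n), (-1) ^ (m.choose 2 + (∑ i ∈ I, (i : ℕ) + I.card.choose 2)) *
        (listPf Z I.sort * listDet W Iᶜ.sort (List.finRange m)) := by
  have hl : List.ofFn (finSumFinEquiv (m := n) (n := m)).symm =
      (List.ofFn id).map .inl ++ (List.finRange m).map .inr := by
    rw [List.ofFn_add, List.map_ofFn, ← List.ofFn_eq_map]
    congr 2 <;> ext i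
    · exact finSumFinEquiv_symm_apply_castAdd i
    · simp
  have h := listPf_ofFn (Matrix.fromBlocks Z W V 0) (finSumFinEquiv (m := n) (n := m)).symm
  rw [hl, listPf_append, splitSum_ofFn] at h
  refine h.symm.trans ?_
  simp only [List.length_finRange, List.map_id, Finset.mul_sum, pow_add, mul_assoc]

end ListExpansions

/-- Okada's bordered-Pfaffian formula: for `n + m` even, `Z` an `n × n` skew-symmetric matrix
and `W` an `n × m` matrix, the Pfaffian of the `(n+m) × (n+m)` skew-symmetric block matrix
`[[Z, W], [-Wᵀ, 0]]` equals
* `Σ_I (-1)^{Σ(I) + C(n,2)} Pf(Z(I)) det W([n]\I; [m])` when `n > m`, the sum being over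
  `(n-m)`-element subsets `I` of `[n]` (indices counted starting from 1),
* `(-1)^{C(n,2)} det W` when `n = m`,
* `0` when `n < m`. -/
theorem pfaffian_bordered (n m : ℕ) (hev : Even (n + m))
    (Z : Matrix (Fin n) (Fin n) ℝ) (hZ : Zᵀ = -Z) (W : Matrix (Fin n) (Fin m) ℝ) :
    (∀ hmn : m < n,
      pf ℝ (n+m) ((Matrix.fromBlocks Z W (-Wᵀ) 0).submatrix
          finSumFinEquiv.symm finSumFinEquiv.symm) =
        ∑ I : {I : Finset (Fin n) // I.card = n - m},
          (-1 : ℝ) ^ ((∑ i ∈ I.1, ((i : ℕ) + 1)) + n.choose 2) *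
            pf ℝ (n - m) (Z.submatrix (I.1.orderEmbOfFin I.2) (I.1.orderEmbOfFin I.2)) *
            (W.submatrix ((I.1ᶜ).orderEmbOfFin
              (by rw [Finset.card_compl, I.2, Fintype.card_fin]; omega)) id).det) ∧
    (∀ hnm : n = m,
      pf ℝ (n+m) ((Matrix.fromBlocks Z W (-Wᵀ) 0).submatrix
          finSumFinEquiv.symm finSumFinEquiv.symm) =
        (-1 : ℝ) ^ n.choose 2 * (W.submatrix id (finCongr hnm)).det) ∧
    (n < m →
      pf ℝ (n+m) ((Matrix.fromBlocks Z W (-Wᵀ) 0).submatrix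
          finSumFinEquiv.symm finSumFinEquiv.symm) = 0) := by
  rw [pf_fromBlocks_zero]
  refine ⟨fun hmn => ?_, fun hnm => ?_, fun hnm => ?_⟩
  · rw [← Finset.sum_subset (Finset.subset_univ (Finset.univ.filter fun I => I.card = n - m)),
      Finset.sum_subtype (p := fun I => I.card = n - m) _ (by simp)]
    · refine Finset.sum_congr rfl fun I _ => ?_
      obtain ⟨I, hI⟩ := I
      have hcard : Iᶜ.card = m := by
        rw [Finset.card_compl, hI, Fintype.card_fin]
        omega
      have hpar : Even (n - m) := by
        obtain ⟨k, hk⟩ := hev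
        exact ⟨k - m, by omega⟩
      rw [← I.listMap_orderEmbOfFin_finRange hI, ← Iᶜ.listMap_orderEmbOfFin_finRange hcard,
        ← List.ofFn_eq_map, ← List.ofFn_eq_map, ← List.ofFn_id m, listPf_ofFn, listDet_ofFn,
        mul_assoc]
      congr 1
      have hn : n.choose 2 = m.choose 2 + (n - m).choose 2 + m * (n - m) := by
        rw [← choose_two_add, Nat.add_sub_cancel' hmn.le]
      rw [hn, Finset.sum_add_distrib, ← Finset.card_eq_sum_ones, hI]
      simp only [pow_add, pow_mul', hpar.neg_one_pow, one_pow]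
      ring
    · intro I _ hI
      rw [listDet_eq_zero, mul_zero, mul_zero]
      have := I.card_le_univ
      simp only [Finset.mem_filter_univ, Finset.length_sort, Finset.card_compl, Fintype.card_fin,
        List.length_finRange] at *
      omega
  · subst hnm
    rw [Finset.sum_eq_single ∅]
    · rw [Finset.compl_empty, Fin.sort_univ, ← List.ofFn_id, listDet_ofFn]
      simp [listPf]
    · intro I _ hI
      rw [listDet_eq_zero, mul_zero, mul_zero]
      have := I.card_le_univ
      have := Finset.card_pos.2 (Finset.nonempty_iff_ne_empty.2 hI)
      simp only [Finset.length_sort, Finset.card_compl, Fintype.card_fin,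
        List.length_finRange] at *
      omega
    · simp
  · refine Finset.sum_eq_zero fun I _ => ?_
    rw [listDet_eq_zero, mul_zero, mul_zero]
    simp [Finset.card_compl]
    omega
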